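/- (Igusa–Raghavan; Theorem 1.1 for r = 1 over ℝ.) Let f : ℝ^m → ℝ be a non-constant polynomial and let c ∈ ℝ be a non-critical value of f, i.e., ∇f(x) ≠ 0 for every x with f(x) = c. For d ∈ ℝ a non-critical value, define the Borel measure μ_d on ℝ^m by μ_d(E) = ∫_{E ∩ f⁻¹(d)} ‖∇f(x)‖⁻¹ dH^{m−1}(x), where H^{m−1} is the (m−1)-dimensional Hausdorff measure. Then there exist constants A > 0, γ ≥ 0 and an open neighborhood U of c consisting of non-critical values such that μ_d(B_R) ≤ A·R^{m−1+γ} for all R ≥ 1 and all d ∈ U, where B_R is the closed ball of radius R centered at 0. In particular, μ_c is tempered: ∫_{ℝ^m} (1 + ‖x‖²)^{−α} dμ_c(x) < ∞ for some integer α. -/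

import Mathlib

open MvPolynomial MeasureTheory

/-- The norm of the gradient of the polynomial `f` at `x` (max-norm). -/
noncomputable def gradNorm {m : ℕ} (f : MvPolynomial (Fin m) ℝ) (x : Fin m → ℝ) : ℝ :=
  ‖fun i => eval x (pderiv i f)‖

/-- The canonical measure `μ_d` on the level set `f⁻¹(d)`:
`μ_d(E) = ∫_{E ∩ f⁻¹(d)} ‖∇f(x)‖⁻¹ dH^{m-1}(x)`. -/
noncomputable def levelMeasure {m : ℕ} (f : MvPolynomial (Fin m) ℝ) (d : ℝ) :
    Measure (Fin m → ℝ) :=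
  ((μH[(m : ℝ) - 1]).restrict {x : Fin m → ℝ | eval x f = d}).withDensity
    fun x => ENNReal.ofReal (gradNorm f x)⁻¹

theorem formallySmooth_field_of_charZero (A K : Type*) [CommRing A] [IsDomain A] [CharZero A]
    [Field K] [Algebra A K] [FaithfulSMul A K] [Algebra.EssFiniteType A K] :
    Algebra.FormallySmooth A K := by
  let := FractionRing.liftAlgebra A K
  have := Algebra.FormallySmooth.of_isLocalization (R := A) (Rₘ := FractionRing A) (nonZeroDivisors A)
  have : Algebra.EssFiniteType (FractionRing A) K := .of_comp A _ _
  have : CharZero (FractionRing A) := charZero_of_injective_algebraMap (IsFractionRing.injective A _)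
  have : Algebra.FormallySmooth (FractionRing A) K := inferInstance
  exact .comp A (FractionRing A) K

theorem linearIndependent_D_of_algebraicIndependent {ι k K : Type*} [Field k] [CharZero k] [Field K]
    [Algebra k K] [Algebra.EssFiniteType k K] {v : ι → K} (hv : AlgebraicIndependent k v) :
    LinearIndependent K (fun i => KaehlerDifferential.D k K (v i)) := by
  let : Algebra (MvPolynomial ι k) K := (aeval v).toAlgebra
  have hmap : ∀ p, algebraMap (MvPolynomial ι k) K p = aeval v p := fun p => rfl
  have : IsScalarTower k (MvPolynomial ι k) K := .of_algebraMap_eq fun x => by simp [hmap]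
  have : FaithfulSMul (MvPolynomial ι k) K := by
    rw [faithfulSMul_iff_algebraMap_injective]; exact hv
  have : Algebra.EssFiniteType (MvPolynomial ι k) K := .of_comp k _ _
  have : CharZero (MvPolynomial ι k) := charZero_of_injective_algebraMap (C_injective ι k)
  have := formallySmooth_field_of_charZero (MvPolynomial ι k) K
  have hinj : Function.Injective (KaehlerDifferential.mapBaseChange k (MvPolynomial ι k) K) := by
    rw [injective_iff_map_eq_zero]
    intro x hx
    obtain ⟨x, rfl⟩ := (Algebra.H1Cotangent.exact_δ_mapBaseChange k (MvPolynomial ι k) K x).mp hx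
    rw [Subsingleton.elim x 0, map_zero]
  have hb := ((KaehlerDifferential.mvPolynomialBasis k ι).baseChange K).linearIndependent
  have := hb.map' (KaehlerDifferential.mapBaseChange k (MvPolynomial ι k) K) (LinearMap.ker_eq_bot.2 hinj)
  convert! this using 1
  ext i
  simp [KaehlerDifferential.mvPolynomialBasis_apply, hmap]

theorem exists_ne_zero_aeval_mem_of_isPrime {r : ℕ} {σ k : Type*} [Finite σ] [Field k] [CharZero k]
    (g : Fin r → MvPolynomial σ k) (P : Ideal (MvPolynomial σ k)) [P.IsPrime]
    (hP : ∀ B : Matrix σ (Fin r) (MvPolynomial σ k), ∀ _ : Fintype σ,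
      (Matrix.of (fun j i => pderiv i (g j)) * B).det ∈ P) :
    ∃ p : MvPolynomial (Fin r) k, p ≠ 0 ∧ aeval g p ∈ P := by
  classical
  cases nonempty_fintype σ
  let S := MvPolynomial σ k ⧸ P
  let K := FractionRing S
  by_contra! hcon
  let φ : MvPolynomial σ k →ₐ[k] K := (IsScalarTower.toAlgHom k S K).comp (Ideal.Quotient.mkₐ k P)
  have hφ : ∀ p, φ p = 0 ↔ p ∈ P := by
    intro p
    change algebraMap S K (Ideal.Quotient.mk P p) = 0 ↔ _
    rw [IsFractionRing.to_map_eq_zero_iff, Ideal.Quotient.eq_zero_iff_mem]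
  have hind : AlgebraicIndependent k (fun j => φ (g j)) := by
    rw [algebraicIndependent_iff]
    intro p hp
    by_contra hp0
    refine hcon p hp0 ((hφ _).1 ?_)
    rw [← hp, ← AlgHom.comp_apply, comp_aeval]
  have : Algebra.EssFiniteType S K := .of_isLocalization _ (nonZeroDivisors S)
  have : Algebra.EssFiniteType k S := inferInstance
  have : Algebra.EssFiniteType k K := .comp k S K
  have hli := linearIndependent_D_of_algebraicIndependent hind
  have hD : ∀ q, KaehlerDifferential.D k K (φ q) =
      ∑ i, φ (pderiv i q) • KaehlerDifferential.D k K (φ (X i)) := by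
    intro q
    induction q using MvPolynomial.induction_on with
    | C a =>
      have h : φ (C a) = algebraMap k K a := φ.commutes a
      simp [h]
    | add p q hp hq => simp only [map_add, hp, hq, add_smul, Finset.sum_add_distrib]
    | mul_X p n hp =>
      simp only [map_mul, Derivation.leibniz, hp, pderiv_X, smul_eq_mul, map_add, add_smul,
        Finset.sum_add_distrib, Finset.smul_sum, smul_smul, Pi.single_apply, mul_ite, mul_one,
        mul_zero]
      congr 1
      rw [Finset.sum_eq_single n]
      · simp
      · intro i _ hi
        simp [hi.symm]
      · simp
  let J : Matrix (Fin r) σ K := Matrix.of fun j i => φ (pderiv i (g j))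
  have hJ : LinearIndependent K J.row := by
    rw [Fintype.linearIndependent_iff] at hli ⊢
    intro c hc
    apply hli c
    simp_rw [fun j => hD (g j), Finset.smul_sum]
    rw [Finset.sum_comm]
    refine Finset.sum_eq_zero fun i _ => ?_
    have h := congrFun hc i
    simp only [Finset.sum_apply, Pi.smul_apply, smul_eq_mul, Matrix.row, J, Matrix.of_apply,
      Pi.zero_apply] at h
    calc _ = (∑ j, c j * φ (pderiv i (g j))) • KaehlerDifferential.D k K (φ (X i)) := by
            rw [Finset.sum_smul]
            exact Finset.sum_congr rfl fun j _ => smul_smul _ _ _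
      _ = 0 := by rw [h, zero_smul]
  obtain ⟨B, hB⟩ : ∃ B : Matrix σ (Fin r) K, J * B = 1 := by
    rw [← Matrix.mulVec_surjective_iff_exists_right_inverse]
    have h := hJ.rank_matrix
    rw [Matrix.rank] at h
    exact LinearMap.range_eq_top (f := J.mulVecLin).1
      (Submodule.eq_top_of_finrank_eq (by simpa using h))
  obtain ⟨b, hb⟩ := IsLocalization.exist_integer_multiples_of_finite (nonZeroDivisors S)
    (fun ij : σ × Fin r => B ij.1 ij.2)
  choose B₁ hB₁ using hb
  choose B₂ hB₂ using fun ij => Ideal.Quotient.mk_surjective (I := P) (B₁ ij)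
  let B' : Matrix σ (Fin r) (MvPolynomial σ k) := Matrix.of fun i j => B₂ (i, j)
  have hmem := hP B' inferInstance
  rw [← hφ, AlgHom.map_det] at hmem
  have hB' : B'.map φ = algebraMap S K b • B := by
    ext i j
    change algebraMap S K (Ideal.Quotient.mk P (B₂ (i, j))) = _
    rw [hB₂, hB₁, Algebra.smul_def]
    rfl
  have hJ' : φ.mapMatrix (Matrix.of (fun j i => pderiv i (g j)) * B') = algebraMap S K b • 1 := by
    have : φ.mapMatrix (Matrix.of (fun j i => pderiv i (g j)) * B') = J * B'.map φ := by
      ext i j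
      simp [Matrix.mul_apply, J]
    rw [this, hB', Matrix.mul_smul, hB]
  rw [hJ', Matrix.det_smul, Matrix.det_one, mul_one] at hmem
  have := eq_zero_of_pow_eq_zero hmem
  rw [IsFractionRing.to_map_eq_zero_iff] at this
  exact nonZeroDivisors.coe_ne_zero b this

theorem exists_ne_zero_eval_eq_zero_of_not_linearIndependent {r : ℕ} {σ k : Type*} [Finite σ]
    [Field k] [CharZero k] (g : Fin r → MvPolynomial σ k) (Z : Set (σ → k))
    (hZ : ∀ x ∈ Z, ¬ LinearIndependent k (fun j i => eval x (pderiv i (g j)))) :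
    ∃ p : MvPolynomial (Fin r) k, p ≠ 0 ∧ ∀ x ∈ Z, eval (fun j => eval x (g j)) p = 0 := by
  classical
  let I := vanishingIdeal k Z
  have hdet : ∀ B : Matrix σ (Fin r) (MvPolynomial σ k), ∀ _ : Fintype σ,
      (Matrix.of (fun j i => pderiv i (g j)) * B).det ∈ I := by
    intro B _ x hx
    have hx := hZ x hx
    contrapose! hx
    let M : Matrix (Fin r) σ k := Matrix.of fun j i => eval x (pderiv i (g j))
    have h1 : aeval x (Matrix.of (fun j i => pderiv i (g j)) * B).det
        = (M * B.map (eval x)).det := by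
      change eval x _ = _
      rw [RingHom.map_det]
      congr 1
      ext i j
      simp [Matrix.mul_apply, M]
    rw [h1] at hx
    have hu : IsUnit (M * B.map (eval x)) := by
      rw [Matrix.isUnit_iff_isUnit_det]; exact hx.isUnit
    have h2 := Matrix.vecMul_injective_of_isUnit hu
    change LinearIndependent k M.row
    rw [← Matrix.vecMul_injective_iff]
    intro u v huv
    apply h2
    simp only [← Matrix.vecMul_vecMul] at huv ⊢
    rw [huv]
  have hprime : ∀ P ∈ I.minimalPrimes, ∃ p : MvPolynomial (Fin r) k, p ≠ 0 ∧ aeval g p ∈ P := by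
    intro P hP
    have := hP.1.1
    exact exists_ne_zero_aeval_mem_of_isPrime g P fun B _ => hP.1.2 (hdet B _)
  choose! p hp0 hpP using hprime
  have hfin := Ideal.finite_minimalPrimes_of_isNoetherianRing _ I
  refine ⟨∏ P ∈ hfin.toFinset, p P, ?_, fun x hx => ?_⟩
  · exact Finset.prod_ne_zero_iff.2 fun P hP => hp0 P (by simpa using hP)
  · have hIx : I ≤ vanishingIdeal k {x} := vanishingIdeal_anti_mono (by simpa using hx)
    obtain ⟨P, hP, hPx⟩ := Ideal.exists_minimalPrimes_le hIx
    rw [map_prod]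
    refine Finset.prod_eq_zero (i := P) (by simpa using hP) ?_
    have := hPx (hpP P hP)
    rw [mem_vanishingIdeal_singleton_iff] at this
    rw [← AlgHom.comp_apply, comp_aeval] at this
    exact this

theorem MvPolynomial.hasStrictFDerivAt_eval {σ : Type*} [Fintype σ] (p : MvPolynomial σ ℝ)
    (x : σ → ℝ) :
    HasStrictFDerivAt (fun y : σ → ℝ => eval y p)
      (∑ i, eval x (pderiv i p) • (ContinuousLinearMap.proj i : (σ → ℝ) →L[ℝ] ℝ)) x := by
  classical
  induction p using MvPolynomial.induction_on with
  | C a => simpa using hasStrictFDerivAt_const a x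
  | add p q hp hq =>
    simp only [map_add, add_smul, Finset.sum_add_distrib]
    exact hp.add hq
  | mul_X p n hp =>
    have h := hp.mul (hasStrictFDerivAt_apply (𝕜 := ℝ) (F' := fun _ : σ => ℝ) n x)
    simp only [eval_mul, eval_X]
    convert! h using 1
    ext v
    simp [Derivation.leibniz, Pi.single_apply, Finset.sum_add_distrib, add_mul,
      Finset.mul_sum, apply_ite (eval x), pderiv_X, mul_assoc]

theorem MvPolynomial.exists_abs_eval_le {σ : Type*} [Fintype σ] (p : MvPolynomial σ ℝ) :
    ∃ C > (0 : ℝ), ∃ N : ℕ, ∀ x : σ → ℝ, |eval x p| ≤ C * (1 + ‖x‖) ^ N := by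
  induction p using MvPolynomial.induction_on with
  | C a => exact ⟨|a| + 1, by positivity, 0, fun x => by simp⟩
  | add p q hp hq =>
    obtain ⟨C, hC, N, h⟩ := hp
    obtain ⟨C', hC', N', h'⟩ := hq
    refine ⟨C + C', by positivity, N + N', fun x => ?_⟩
    have h1 : (1 : ℝ) ≤ 1 + ‖x‖ := by linarith [norm_nonneg x]
    have h2 : (1 + ‖x‖) ^ N ≤ (1 + ‖x‖) ^ (N + N') := pow_le_pow_right₀ h1 (by simp)
    have h3 : (1 + ‖x‖) ^ N' ≤ (1 + ‖x‖) ^ (N + N') := pow_le_pow_right₀ h1 (by simp)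
    calc |eval x (p + q)| ≤ |eval x p| + |eval x q| := by rw [eval_add]; exact abs_add_le _ _
      _ ≤ C * (1 + ‖x‖) ^ N + C' * (1 + ‖x‖) ^ N' := add_le_add (h x) (h' x)
      _ ≤ C * (1 + ‖x‖) ^ (N + N') + C' * (1 + ‖x‖) ^ (N + N') := by gcongr
      _ = _ := by ring
  | mul_X p n hp =>
    obtain ⟨C, hC, N, h⟩ := hp
    refine ⟨C, hC, N + 1, fun x => ?_⟩
    have : |x n| ≤ 1 + ‖x‖ := by linarith [norm_le_pi_norm x n, Real.norm_eq_abs (x n)]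
    rw [eval_mul, eval_X, abs_mul, pow_succ, ← mul_assoc]
    exact mul_le_mul (h x) this (abs_nonneg _) (by positivity)

theorem Polynomial.exists_pos_le_abs_eval {u : Polynomial ℝ} (hu : u ≠ 0) :
    ∃ b > (0 : ℝ), ∃ s₀ : ℝ, ∀ t ≥ s₀, b ≤ |u.eval t| := by
  by_cases hdeg : 0 < u.degree
  · obtain ⟨s₀, h⟩ := Filter.eventually_atTop.1
      ((u.abs_tendsto_atTop hdeg).eventually (Filter.eventually_ge_atTop 1))
    exact ⟨1, one_pos, s₀, h⟩
  · have h := Polynomial.eq_C_of_degree_le_zero (not_lt.1 hdeg)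
    have hc : u.coeff 0 ≠ 0 := fun h0 => hu (by rw [h, h0, map_zero])
    refine ⟨|u.coeff 0|, by positivity, 0, fun t _ => ?_⟩
    rw [h]; simp

theorem MvPolynomial.exists_ne_zero_eval_eq {p : MvPolynomial (Fin 1) ℝ} (hp : p ≠ 0) :
    ∃ u : Polynomial ℝ, u ≠ 0 ∧ ∀ t, u.eval t = eval ![t] p := by
  have heval : ∀ t, (aeval (fun _ => Polynomial.X) p : Polynomial ℝ).eval t = eval ![t] p := by
    intro t
    change Polynomial.aeval t (aeval _ _) = _
    rw [← AlgHom.comp_apply, comp_aeval]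
    simp only [Polynomial.aeval_X]
    rw [show (fun _ : Fin 1 => t) = ![t] by ext i; fin_cases i; rfl]
    rfl
  refine ⟨_, fun h0 => hp (MvPolynomial.funext fun x => ?_), heval⟩
  have := heval (x 0)
  rw [h0, Polynomial.eval_zero] at this
  rw [map_zero, this, show (![x 0] : Fin 1 → ℝ) = x by ext i; fin_cases i; rfl]

/-- A nonzero bivariate polynomial vanishing at `(q, s)` with `q ≠ 0` gives a lower bound on `|q|`
that is polynomial in `s`. -/
theorem MvPolynomial.exists_lower_bound_of_eval_eq_zero {p : MvPolynomial (Fin 2) ℝ} (hp : p ≠ 0) :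
    ∃ b > (0 : ℝ), ∃ N : ℕ, ∃ s₀ : ℝ, ∀ q s : ℝ, 0 < q → q ≤ 1 → 0 ≤ s → s₀ ≤ s →
      eval ![q, s] p = 0 → b ≤ q * (2 + s) ^ N := by
  let F := finSuccEquiv ℝ 1 p
  have hF : F ≠ 0 := by simpa [F] using hp
  obtain ⟨G, hFG, hG⟩ := F.exists_eq_pow_rootMultiplicity_mul_and_not_dvd hF 0
  rw [Polynomial.C_0, sub_zero] at hFG hG
  rw [Polynomial.X_dvd_iff] at hG
  obtain ⟨u, hu, heval⟩ := exists_ne_zero_eval_eq hG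
  obtain ⟨b, hb, s₀, hbs⟩ := Polynomial.exists_pos_le_abs_eval hu
  obtain ⟨C, hC, N, hCN⟩ := exists_abs_eval_le ((finSuccEquiv ℝ 1).symm G.divX)
  refine ⟨b / C, by positivity, N, s₀, fun q s hq hq1 hs hs₀ h => ?_⟩
  have hcons : (![q, s] : Fin 2 → ℝ) = Fin.cons q ![s] := rfl
  rw [hcons, eval_eq_eval_mv_eval'] at h
  change Polynomial.eval q (F.map _) = 0 at h
  rw [hFG, Polynomial.map_mul, Polynomial.eval_mul] at h
  simp only [Polynomial.map_pow, Polynomial.map_X, Polynomial.eval_pow, Polynomial.eval_X,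
    mul_eq_zero, pow_eq_zero_iff', hq.ne', false_and, false_or] at h
  have h2 := hCN ![q, s]
  rw [hcons, eval_eq_eval_mv_eval', AlgEquiv.apply_symm_apply] at h2
  rw [← G.divX_mul_X_add] at h
  simp only [Polynomial.map_add, Polynomial.map_mul, Polynomial.map_X, Polynomial.map_C,
    Polynomial.eval_add, Polynomial.eval_mul, Polynomial.eval_X, Polynomial.eval_C] at h
  have h3 := hbs s hs₀
  rw [heval, eq_neg_of_add_eq_zero_right h, abs_neg, abs_mul, abs_of_pos hq] at h3
  have hnorm : ‖(Fin.cons q ![s] : Fin 2 → ℝ)‖ ≤ 1 + s := by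
    rw [pi_norm_le_iff_of_nonneg (by linarith)]
    intro i
    fin_cases i
    · simpa [abs_of_pos hq] using by linarith
    · simp [abs_of_nonneg hs]
  rw [div_le_iff₀ hC]
  calc b ≤ _ := h3
    _ ≤ (C * (1 + ‖(Fin.cons q ![s] : Fin 2 → ℝ)‖) ^ N) * q := by gcongr
    _ ≤ (C * (1 + (1 + s)) ^ N) * q := by gcongr
    _ = _ := by ring

theorem MvPolynomial.exists_lower_bound_of_pos {σ : Type*} [Fintype σ] (Q : MvPolynomial σ ℝ)
    (hQ : ∀ x : σ → ℝ, 0 < eval x Q) :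
    ∃ a > (0 : ℝ), ∃ N : ℕ, ∀ x : σ → ℝ, a ≤ eval x Q * (1 + ‖x‖) ^ N := by
  classical
  let h : MvPolynomial σ ℝ := ∑ i, X i ^ 2
  have hh : ∀ x : σ → ℝ, eval x h = ∑ i, x i ^ 2 := fun x => by simp [h]
  have hnorm : ∀ x : σ → ℝ, ‖x‖ ^ 2 ≤ eval x h := by
    intro x
    rw [hh]
    have hle : ‖x‖ ≤ √(∑ i, x i ^ 2) := by
      rw [pi_norm_le_iff_of_nonneg (Real.sqrt_nonneg _)]
      intro i
      apply Real.le_sqrt_of_sq_le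
      rw [Real.norm_eq_abs, sq_abs]
      exact Finset.single_le_sum (f := fun i => x i ^ 2) (fun i _ => sq_nonneg _)
        (Finset.mem_univ i)
    calc ‖x‖ ^ 2 ≤ √(∑ i, x i ^ 2) ^ 2 := by gcongr
      _ = _ := Real.sq_sqrt (Finset.sum_nonneg fun i _ => sq_nonneg _)
  let Z : Set (σ → ℝ) :=
    {x | ¬ LinearIndependent ℝ (fun (j : Fin 2) i => eval x (pderiv i (![Q, h] j)))}
  obtain ⟨p, hp, hpZ⟩ := exists_ne_zero_eval_eq_zero_of_not_linearIndependent ![Q, h] Z fun x hx => hx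
  obtain ⟨b, hb, N, s₀, hbN⟩ := exists_lower_bound_of_eval_eq_zero hp
  have hQc : Continuous fun x : σ → ℝ => eval x Q := continuous_eval Q
  have hhc : Continuous fun x : σ → ℝ => eval x h := continuous_eval h
  obtain ⟨a, ha, haQ⟩ : ∃ a > 0, ∀ x ∈ Metric.closedBall (0 : σ → ℝ) (√|s₀|), a ≤ eval x Q := by
    obtain ⟨x₀, -, hx₀⟩ := (isCompact_closedBall (0 : σ → ℝ) (√|s₀|)).exists_isMinOn
      ⟨0, by simp⟩ hQc.continuousOn
    exact ⟨_, hQ x₀, fun x hx => hx₀ hx⟩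
  obtain ⟨D, hD, M, hDM⟩ := exists_abs_eval_le (2 + h)
  have hlarge : ∀ x, s₀ ≤ eval x h → min 1 b ≤ eval x Q * (2 + eval x h) ^ N := by
    intro x hx
    have hpos : 0 ≤ eval x h := (sq_nonneg _).trans (hnorm x)
    have hcomp : IsCompact {y : σ → ℝ | eval y h = eval x h} := by
      refine (isCompact_closedBall (0 : σ → ℝ) (√(eval x h))).of_isClosed_subset
        (isClosed_eq hhc continuous_const) fun y hy => ?_
      rw [mem_closedBall_zero_iff]
      apply Real.le_sqrt_of_sq_le
      rw [← show eval y h = eval x h from hy]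
      exact hnorm y
    obtain ⟨y, hy, hmin⟩ := hcomp.exists_isMinOn ⟨x, rfl⟩ hQc.continuousOn
    have hyx : eval y h = eval x h := hy
    have hyZ : y ∈ Z := by
      have hext : IsLocalExtrOn (fun x : σ → ℝ => eval x Q) {z | eval z h = eval y h} y := by
        rw [hyx]
        exact Or.inl hmin.localize
      obtain ⟨α, β, hαβ, hlin⟩ := hext.exists_multipliers_of_hasStrictFDerivAt_1d
        (hasStrictFDerivAt_eval h y) (hasStrictFDerivAt_eval Q y)
      change ¬ LinearIndependent ℝ _
      rw [Fintype.linearIndependent_iff]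
      intro hli
      have := hli ![β, α] (by
        ext i
        have := congrArg (fun L => L (Pi.single i 1)) hlin
        simp [Pi.single_apply] at this
        simp [Fin.sum_univ_two]
        linarith)
      refine hαβ (Prod.ext (this 1) (this 0))
    have hzero := hpZ y hyZ
    have hvec : (fun j => eval y ((![Q, h] : Fin 2 → MvPolynomial σ ℝ) j)) = ![eval y Q, eval x h] := by
      ext j; fin_cases j <;> simp [hyx]
    rw [hvec] at hzero
    have hxy : eval y Q ≤ eval x Q := hmin (show eval x h = eval x h from rfl)
    have h1 : (1 : ℝ) ≤ (2 + eval x h) ^ N := one_le_pow₀ (by linarith)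
    rcases le_total (eval y Q) 1 with h2 | h2
    · calc min 1 b ≤ b := min_le_right _ _
        _ ≤ eval y Q * (2 + eval x h) ^ N := hbN _ _ (hQ y) h2 hpos hx hzero
        _ ≤ _ := by gcongr
    · calc min 1 b ≤ 1 := min_le_left _ _
        _ ≤ eval x Q := h2.trans hxy
        _ ≤ _ := le_mul_of_one_le_right (hQ x).le h1
  refine ⟨min a (min 1 b / D ^ N), by positivity, M * N, fun x => ?_⟩
  have h1 : (1 : ℝ) ≤ (1 + ‖x‖) ^ (M * N) := one_le_pow₀ (by linarith [norm_nonneg x])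
  by_cases hx : ‖x‖ ≤ √|s₀|
  · calc _ ≤ a := min_le_left _ _
      _ ≤ eval x Q := haQ x (by simpa using hx)
      _ ≤ _ := le_mul_of_one_le_right (hQ x).le h1
  · have hpos : 0 ≤ eval x h := (sq_nonneg _).trans (hnorm x)
    have hs : s₀ ≤ eval x h := by
      refine le_trans ?_ (hnorm x)
      rw [not_le] at hx
      rw [Real.sqrt_lt' (lt_of_le_of_lt (Real.sqrt_nonneg _) hx)] at hx
      exact (le_abs_self _).trans hx.le
    refine (min_le_right _ _).trans ?_
    rw [div_le_iff₀ (by positivity)]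
    have h2 := hDM x
    have h3 : |eval x (2 + h)| = 2 + eval x h := by
      rw [eval_add, map_ofNat, abs_of_nonneg (by linarith)]
    rw [h3] at h2
    have h4 := (hQ x).le
    calc _ ≤ eval x Q * (2 + eval x h) ^ N := hlarge x hs
      _ ≤ eval x Q * (D * (1 + ‖x‖) ^ M) ^ N := by gcongr
      _ = _ := by rw [mul_pow, pow_mul]; ring

theorem MvPolynomial.finite_criticalValues {σ : Type*} [Finite σ] (f : MvPolynomial σ ℝ) :
    {d : ℝ | ∃ x : σ → ℝ, eval x f = d ∧ ∀ i, eval x (pderiv i f) = 0}.Finite := by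
  let Z : Set (σ → ℝ) := {x | ∀ i, eval x (pderiv i f) = 0}
  have hZ : ∀ x ∈ Z, ¬ LinearIndependent ℝ
      (fun (j : Fin 1) i => eval x (pderiv i ((fun _ => f : Fin 1 → MvPolynomial σ ℝ) j))) :=
    fun x hx hli => hli.ne_zero 0 (by ext i; exact hx i)
  obtain ⟨p, hp, hpZ⟩ := exists_ne_zero_eval_eq_zero_of_not_linearIndependent _ Z hZ
  obtain ⟨u, hu, hup⟩ := exists_ne_zero_eval_eq hp
  have hroots : {t | u.IsRoot t}.Finite := Polynomial.finite_setOfPred_isRoot hu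
  refine hroots.subset ?_
  rintro _ ⟨x, rfl, hx⟩
  have h := hpZ x hx
  rw [show (fun _ => eval x f) = ![eval x f] by ext j; fin_cases j; rfl, ← hup] at h
  exact h

theorem exists_two_mul_eq_one_add_sq_mul {y : ℝ} (hy : |y| ≤ 1) :
    ∃ t : ℝ, |t| ≤ 1 ∧ (1 + t ^ 2) * y = 2 * t := by
  have hy2 : 0 ≤ 1 - y ^ 2 := by
    have := (sq_le_one_iff_abs_le_one y).2 hy
    linarith
  have hw := Real.sqrt_nonneg (1 - y ^ 2)
  have hw2 := Real.sq_sqrt hy2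
  set w := √(1 - y ^ 2)
  have h1 : (0 : ℝ) < 1 + w := by linarith
  refine ⟨y / (1 + w), ?_, ?_⟩
  · rw [abs_div, abs_of_pos h1, div_le_one h1]
    linarith
  · field_simp
    linear_combination y * hw2

theorem exists_gradNorm_lower_bound {m : ℕ} (f : MvPolynomial (Fin m) ℝ) {c ε : ℝ} (hε : 0 < ε)
    (hc : ∀ x : Fin m → ℝ, |eval x f - c| ≤ ε → ∃ i, eval x (pderiv i f) ≠ 0) :
    ∃ a > (0 : ℝ), ∃ N : ℕ, ∀ x : Fin m → ℝ, |eval x f - c| ≤ ε →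
      a ≤ gradNorm f x * (1 + ‖x‖) ^ N := by
  let S : MvPolynomial (Fin m) ℝ := ∑ i, pderiv i f ^ 2
  let T : MvPolynomial (Option (Fin m)) ℝ := X none
  let Q : MvPolynomial (Option (Fin m)) ℝ :=
    rename some S + ((1 + T ^ 2) * (rename some f - C c) - C (2 * ε) * T) ^ 2
  have hQe : ∀ z, eval z Q = ∑ i, eval (z ∘ some) (pderiv i f) ^ 2 +
      ((1 + z none ^ 2) * (eval (z ∘ some) f - c) - 2 * ε * z none) ^ 2 := by
    intro z
    simp [Q, S, T, eval_rename]
  have hQ : ∀ z, 0 < eval z Q := by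
    intro z
    have h1 : 0 ≤ ∑ i, eval (z ∘ some) (pderiv i f) ^ 2 := Finset.sum_nonneg fun i _ => sq_nonneg _
    have h2 := sq_nonneg ((1 + z none ^ 2) * (eval (z ∘ some) f - c) - 2 * ε * z none)
    rw [hQe]
    by_contra! h
    have h3 : ∑ i, eval (z ∘ some) (pderiv i f) ^ 2 = 0 := by linarith
    have h4 : ((1 + z none ^ 2) * (eval (z ∘ some) f - c) - 2 * ε * z none) ^ 2 = 0 := by linarith
    rw [sq_eq_zero_iff, sub_eq_zero] at h4
    obtain ⟨i, hi⟩ := hc (z ∘ some) (by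
      have h5 : 0 < 1 + z none ^ 2 := by positivity
      rw [abs_le]
      constructor
      · have := mul_nonneg hε.le (sq_nonneg (z none + 1))
        by_contra! hlt
        have := mul_lt_mul_of_pos_left hlt h5
        linarith
      · have := mul_nonneg hε.le (sq_nonneg (z none - 1))
        by_contra! hlt
        have := mul_lt_mul_of_pos_left hlt h5
        linarith)
    rw [Finset.sum_eq_zero_iff_of_nonneg fun i _ => sq_nonneg _] at h3
    exact hi (pow_eq_zero_iff two_ne_zero |>.1 (h3 i (Finset.mem_univ i)))
  obtain ⟨a, ha, N, hN⟩ := exists_lower_bound_of_pos Q hQ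
  refine ⟨√(a / ((m + 1) * 2 ^ N)), by positivity, N, fun x hx => ?_⟩
  obtain ⟨t, ht, hty⟩ := exists_two_mul_eq_one_add_sq_mul (y := (eval x f - c) / ε)
    (by rwa [abs_div, abs_of_pos hε, div_le_one hε])
  let z : Option (Fin m) → ℝ := fun o => o.elim t x
  have hz : z ∘ some = x := rfl
  have hzn : ‖z‖ ≤ 1 + ‖x‖ := by
    rw [pi_norm_le_iff_of_nonneg (by positivity)]
    rintro (_ | i)
    · exact ht.trans (by linarith [norm_nonneg x])
    · exact (norm_le_pi_norm x i).trans (by linarith)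
  have h1 := hN z
  rw [hQe, hz] at h1
  have h2 : (1 + z none ^ 2) * (eval x f - c) - 2 * ε * z none = 0 := by
    change (1 + t ^ 2) * (eval x f - c) - 2 * ε * t = 0
    field_simp at hty
    linarith
  rw [h2] at h1
  have hg : ∑ i, eval x (pderiv i f) ^ 2 ≤ (m + 1) * gradNorm f x ^ 2 := by
    calc ∑ i, eval x (pderiv i f) ^ 2 ≤ ∑ _i : Fin m, gradNorm f x ^ 2 := by
          refine Finset.sum_le_sum fun i _ => ?_
          rw [← sq_abs, ← Real.norm_eq_abs]
          have := norm_le_pi_norm (fun i => eval x (pderiv i f)) i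
          unfold gradNorm
          gcongr
      _ = m * gradNorm f x ^ 2 := by simp
      _ ≤ _ := by gcongr; linarith
  have hg0 : 0 ≤ gradNorm f x := norm_nonneg _
  apply Real.sqrt_le_iff.2
  refine ⟨by positivity, ?_⟩
  rw [div_le_iff₀ (by positivity)]
  have hx1 : (1 : ℝ) ≤ (1 + ‖x‖) ^ N := one_le_pow₀ (by linarith [norm_nonneg x])
  calc a ≤ (∑ i, eval x (pderiv i f) ^ 2) * (1 + ‖z‖) ^ N := by simpa using h1
    _ ≤ ((m + 1) * gradNorm f x ^ 2) * (2 * (1 + ‖x‖)) ^ N := by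
      gcongr
      linarith [norm_nonneg x]
    _ = ((m + 1) * gradNorm f x ^ 2) * (2 ^ N * (1 + ‖x‖) ^ N) := by rw [mul_pow]
    _ ≤ ((m + 1) * gradNorm f x ^ 2) * (2 ^ N * ((1 + ‖x‖) ^ N * (1 + ‖x‖) ^ N)) := by
      gcongr
      exact le_mul_of_one_le_left (by positivity) hx1
    _ = _ := by ring

/-- A measurable set on which a map to `Y` has fibers of cardinality at most `D` and is locally
expanding up to a factor `L` has Hausdorff measure controlled by that of its image. -/
theorem hausdorffMeasure_le_of_locally_antilipschitz {X Y : Type*} [MetricSpace X]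
    [MeasurableSpace X] [BorelSpace X] [PolishSpace X] [MetricSpace Y] [MeasurableSpace Y]
    [BorelSpace Y] [SecondCountableTopology Y] {π : X → Y} (hπ : Continuous π) {S : Set X}
    (hS : MeasurableSet S) {L : NNReal} {D : ℕ} {d : ℝ} (hd : 0 ≤ d)
    (hloc : ∀ x ∈ S, ∃ V ∈ nhds x, ∀ y ∈ S ∩ V, ∀ z ∈ S ∩ V, dist y z ≤ L * dist (π y) (π z))
    (hfib : ∀ w, (S ∩ π ⁻¹' {w}).encard ≤ D) {W : Set Y} (hW : MeasurableSet W)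
    (hSW : Set.MapsTo π S W) :
    μH[d] S ≤ (L : ENNReal) ^ d * (D * μH[d] W) := by
  classical
  rcases S.eq_empty_or_nonempty with rfl | ⟨x₀, hx₀⟩
  · simp
  have : Nonempty X := ⟨x₀⟩
  have hloc' : ∀ x, ∃ V, IsOpen V ∧ (x ∈ S → x ∈ V) ∧
      ∀ y ∈ S ∩ V, ∀ z ∈ S ∩ V, dist y z ≤ L * dist (π y) (π z) := by
    intro x
    by_cases hx : x ∈ S
    · obtain ⟨V, hV, h⟩ := hloc x hx
      obtain ⟨V', hV', ho, hxV⟩ := mem_nhds_iff.1 hV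
      exact ⟨V', ho, fun _ => hxV, fun y hy z hz => h y ⟨hy.1, hV' hy.2⟩ z ⟨hz.1, hV' hz.2⟩⟩
    · exact ⟨∅, isOpen_empty, fun h => (hx h).elim, by simp⟩
  choose V hVo hxV hVL using hloc'
  obtain ⟨t, -, htc, htS⟩ := TopologicalSpace.countable_cover_nhdsWithin (f := V) (s := S)
    fun x hx => mem_nhdsWithin_of_mem_nhds ((hVo x).mem_nhds (hxV x hx))
  have htne : t.Nonempty := by
    obtain ⟨y, hy, -⟩ := Set.mem_iUnion₂.1 (htS hx₀)
    exact ⟨y, hy⟩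
  obtain ⟨e, rfl⟩ := htc.exists_eq_range htne
  let T : ℕ → Set X := fun k => S ∩ disjointed (fun k => V (e k)) k
  have hTm : ∀ k, MeasurableSet (T k) := fun k =>
    hS.inter (MeasurableSet.disjointed (fun k => (hVo (e k)).measurableSet) k)
  have hTL : ∀ k, ∀ y ∈ T k, ∀ z ∈ T k, dist y z ≤ L * dist (π y) (π z) := fun k y hy z hz =>
    hVL (e k) y ⟨hy.1, disjointed_subset _ k hy.2⟩ z ⟨hz.1, disjointed_subset _ k hz.2⟩
  have hinj : ∀ k, Set.InjOn π (T k) := by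
    intro k y hy z hz h
    have := hTL k y hy z hz
    rw [h, dist_self, mul_zero] at this
    exact dist_le_zero.1 this
  have hTimg : ∀ k, MeasurableSet (π '' T k) := fun k =>
    (hTm k).image_of_continuousOn_injOn hπ.continuousOn (hinj k)
  have hcover : S ⊆ ⋃ k, T k := by
    intro x hx
    rw [← Set.inter_iUnion, iUnion_disjointed]
    refine ⟨hx, ?_⟩
    simpa using htS hx
  have hT : ∀ k, μH[d] (T k) ≤ (L : ENNReal) ^ d * μH[d] (π '' T k) := by
    intro k
    have hlip : LipschitzOnWith L (Function.invFunOn π (T k)) (π '' T k) := by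
      refine LipschitzOnWith.of_dist_le_mul ?_
      rintro _ ⟨y, hy, rfl⟩ _ ⟨z, hz, rfl⟩
      rw [(hinj k).leftInvOn_invFunOn hy, (hinj k).leftInvOn_invFunOn hz]
      exact hTL k y hy z hz
    have h := hlip.hausdorffMeasure_image_le hd
    rwa [(hinj k).leftInvOn_invFunOn.image_image] at h
  have hcount : ∀ w, ∑' k, (π '' T k).indicator (1 : Y → ENNReal) w ≤
      W.indicator (fun _ => (D : ENNReal)) w := by
    intro w
    by_cases hw : w ∈ W
    · rw [Set.indicator_of_mem hw, ENNReal.tsum_eq_iSup_sum]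
      refine iSup_le fun F => ?_
      simp only [Set.indicator_apply, Pi.one_apply, Finset.sum_boole]
      norm_cast
      have hch : ∀ k, ∃ x, w ∈ π '' T k → x ∈ T k ∧ π x = w := fun k => by
        by_cases h : w ∈ π '' T k
        · obtain ⟨x, hx⟩ := h; exact ⟨x, fun _ => hx⟩
        · exact ⟨x₀, fun h' => (h h').elim⟩
      choose g hg using hch
      have hinj' : Set.InjOn g (F.filter fun k => w ∈ π '' T k) := by
        intro k hk l hl hkl
        by_contra hne
        have hk' := (hg k (Finset.mem_filter.1 hk).2).1.2
        have hl' := (hg l (Finset.mem_filter.1 hl).2).1.2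
        rw [hkl] at hk'
        exact (Set.disjoint_left.1 (disjoint_disjointed _ hne)) hk' hl'
      have hsub : g '' (F.filter fun k => w ∈ π '' T k) ⊆ S ∩ π ⁻¹' {w} := by
        rintro _ ⟨k, hk, rfl⟩
        have := hg k (Finset.mem_filter.1 hk).2
        exact ⟨this.1.1, this.2⟩
      have := (Set.encard_le_encard hsub).trans (hfib w)
      rw [hinj'.encard_image, Set.encard_coe_eq_coe_finsetCard] at this
      exact_mod_cast this
    · rw [Set.indicator_of_notMem hw]
      refine le_of_eq (ENNReal.tsum_eq_zero.2 fun k => Set.indicator_of_notMem ?_ _)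
      rintro ⟨x, hx, rfl⟩
      exact hw (hSW hx.1)
  calc μH[d] S ≤ ∑' k, μH[d] (T k) := (measure_mono hcover).trans (measure_iUnion_le _)
    _ ≤ ∑' k, (L : ENNReal) ^ d * μH[d] (π '' T k) := ENNReal.tsum_le_tsum hT
    _ = (L : ENNReal) ^ d * ∑' k, μH[d] (π '' T k) := ENNReal.tsum_mul_left
    _ = (L : ENNReal) ^ d * ∫⁻ w, ∑' k, (π '' T k).indicator 1 w ∂μH[d] := by
      rw [lintegral_tsum fun k => (measurable_one.indicator (hTimg k)).aemeasurable]
      simp_rw [lintegral_indicator_one (hTimg _)]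
    _ ≤ (L : ENNReal) ^ d * ∫⁻ w, W.indicator (fun _ => (D : ENNReal)) w ∂μH[d] := by
      gcongr with w
      exact hcount w
    _ = _ := by rw [lintegral_indicator_const hW]

/-- Near a point where the `i`-th partial derivative of `f` dominates the others and is nonzero,
the level sets of `f` are graphs over the remaining coordinates, with uniform slope. -/
theorem exists_nhds_dist_le_removeNth {n : ℕ} (f : MvPolynomial (Fin (n + 1)) ℝ)
    (i : Fin (n + 1)) {x : Fin (n + 1) → ℝ} (hi : eval x (pderiv i f) ≠ 0)
    (hdom : ∀ j, |eval x (pderiv j f)| ≤ |eval x (pderiv i f)|) :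
    ∃ V ∈ nhds x, ∀ y ∈ V, ∀ z ∈ V, eval y f = eval z f →
      dist y z ≤ (2 * n + 1) * dist (i.removeNth y) (i.removeNth z) := by
  have hG : 0 < |eval x (pderiv i f)| := abs_pos.2 hi
  set G := |eval x (pderiv i f)|
  obtain ⟨V, hV, hVlin⟩ := (hasStrictFDerivAt_eval f x).approximates_deriv_on_nhds
    (c := NNReal.mk (G / 2) (by positivity))
    (Or.inr (NNReal.coe_pos.1 (half_pos hG)))
  refine ⟨V, hV, fun y hy z hz hyz => ?_⟩
  have h := hVlin y hy z hz
  beta_reduce at h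
  rw [hyz, sub_self, zero_sub, norm_neg] at h
  simp only [FunLike.coe_sum, Finset.sum_apply, FunLike.coe_smul,
    Pi.smul_apply, ContinuousLinearMap.proj_apply, smul_eq_mul, Pi.sub_apply] at h
  rw [Fin.sum_univ_succAbove _ i, NNReal.coe_mk] at h
  rw [dist_eq_norm, dist_eq_norm]
  set ρ := ‖i.removeNth y - i.removeNth z‖
  have hρ0 : 0 ≤ ρ := norm_nonneg _
  have hρ : ∀ j, |y (i.succAbove j) - z (i.succAbove j)| ≤ ρ := fun j =>
    norm_le_pi_norm (i.removeNth y - i.removeNth z) j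
  have hv : ‖y - z‖ ≤ |y i - z i| + ρ := by
    rw [pi_norm_le_iff_of_nonneg (by positivity)]
    intro k
    rcases Fin.eq_self_or_eq_succAbove i k with rfl | ⟨j, rfl⟩
    · simpa [Real.norm_eq_abs] using hρ0
    · exact (hρ j).trans (by simp)
  have hsum : |∑ j, eval x (pderiv (i.succAbove j) f) * (y (i.succAbove j) - z (i.succAbove j))| ≤
      n * (G * ρ) := by
    calc _ ≤ ∑ j : Fin n, G * ρ := (Finset.abs_sum_le_sum_abs _ _).trans
          (Finset.sum_le_sum fun j _ => by
            rw [abs_mul]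
            exact mul_le_mul (hdom _) (hρ j) (abs_nonneg _) hG.le)
      _ = _ := by simp
  have hmain : G * |y i - z i| ≤ G / 2 * (|y i - z i| + ρ) + n * (G * ρ) := by
    rw [← abs_mul]
    have h2 : G / 2 * ‖y - z‖ ≤ G / 2 * (|y i - z i| + ρ) := by gcongr
    rw [Real.norm_eq_abs] at h
    have h3 := abs_le.1 (h.trans h2)
    have h4 := abs_le.1 hsum
    exact abs_le.2 ⟨by linarith, by linarith⟩
  have hyi : |y i - z i| ≤ (2 * n + 1) * ρ := by
    refine le_of_mul_le_mul_left ?_ hG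
    linarith
  rw [pi_norm_le_iff_of_nonneg (by positivity)]
  intro k
  rcases Fin.eq_self_or_eq_succAbove i k with rfl | ⟨j, rfl⟩
  · exact hyi
  · exact (hρ j).trans (le_mul_of_one_le_left hρ0 (by linarith [Nat.cast_nonneg (α := ℝ) n]))

theorem encard_fiber_removeNth_le {n : ℕ} (f : MvPolynomial (Fin (n + 1)) ℝ) (i : Fin (n + 1))
    (d : ℝ) (w : Fin n → ℝ) :
    ({x : Fin (n + 1) → ℝ | eval x f = d ∧ eval x (pderiv i f) ≠ 0} ∩
      i.removeNth ⁻¹' {w}).encard ≤ f.totalDegree := by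
  let u : Polynomial ℝ := aeval (i.insertNth Polynomial.X fun j => Polynomial.C (w j)) f
  have hu : ∀ t, u.eval t = eval (i.insertNth t w : Fin (n + 1) → ℝ) f := by
    intro t
    change Polynomial.aeval t (aeval _ _) = _
    rw [← AlgHom.comp_apply, comp_aeval]
    have hw : (fun k => Polynomial.aeval t ((i.insertNth Polynomial.X
        fun j => Polynomial.C (w j) : Fin (n + 1) → Polynomial ℝ) k)) = i.insertNth t w := by
      ext k
      rcases Fin.eq_self_or_eq_succAbove i k with rfl | ⟨j, rfl⟩ <;> simp
    rw [hw]
    rfl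
  have hdeg : u.natDegree ≤ f.totalDegree := by
    have := aeval_natDegree_le (n := 1) f le_rfl
      (i.insertNth Polynomial.X fun j => Polynomial.C (w j)) (fun k => by
        rcases Fin.eq_self_or_eq_succAbove i k with rfl | ⟨j, rfl⟩ <;> simp)
    simpa using this
  rcases Set.eq_empty_or_nonempty ({x : Fin (n + 1) → ℝ | eval x f = d ∧ eval x (pderiv i f) ≠ 0} ∩
      i.removeNth ⁻¹' {w}) with h | ⟨x, ⟨hxd, hxi⟩, hxw⟩
  · simp [h]
  have hxw : i.removeNth x = w := hxw
  have hx : i.insertNth (x i) w = x := by rw [← hxw, Fin.insertNth_self_removeNth]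
  have hne : u - Polynomial.C d ≠ 0 := by
    intro h0
    have hconst : ∀ t, eval (i.insertNth t w : Fin (n + 1) → ℝ) f = d := fun t => by
      rw [← hu, sub_eq_zero.1 h0, Polynomial.eval_C]
    have hline : HasDerivAt (fun t : ℝ => (i.insertNth t w : Fin (n + 1) → ℝ)) (Pi.single i 1)
        (x i) := by
      rw [hasDerivAt_pi]
      intro k
      rcases Fin.eq_self_or_eq_succAbove i k with h | ⟨j, rfl⟩
      · subst h
        simpa using hasDerivAt_id' (x k)
      · simpa using hasDerivAt_const (x i) (w j)
    have hder := (hasStrictFDerivAt_eval f (i.insertNth (x i) w)).hasFDerivAt.comp_hasDerivAt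
      (x i) hline
    have hder' : HasDerivAt ((fun y : Fin (n + 1) → ℝ => eval y f) ∘
        fun t : ℝ => (i.insertNth t w : Fin (n + 1) → ℝ)) 0 (x i) := by
      convert! hasDerivAt_const (x i) d using 1
      ext t
      exact hconst t
    have := hder.unique hder'
    rw [hx] at this
    apply hxi
    simpa [Pi.single_apply] using this
  have hsub : ({x : Fin (n + 1) → ℝ | eval x f = d ∧ eval x (pderiv i f) ≠ 0} ∩
      i.removeNth ⁻¹' {w}) ⊆
      (fun t => (i.insertNth t w : Fin (n + 1) → ℝ)) '' (u - Polynomial.C d).roots.toFinset := by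
    rintro y ⟨⟨hyd, -⟩, hyw⟩
    have hyw : i.removeNth y = w := hyw
    have hy : i.insertNth (y i) w = y := by rw [← hyw, Fin.insertNth_self_removeNth]
    refine ⟨y i, ?_, hy⟩
    simp [hne, hu, hy, hyd]
  calc _ ≤ _ := Set.encard_le_encard hsub
    _ ≤ _ := Set.encard_image_le _ _
    _ ≤ f.totalDegree := by
      rw [Set.encard_coe_eq_coe_finsetCard]
      norm_cast
      calc _ ≤ _ := Multiset.toFinset_card_le _
        _ ≤ _ := Polynomial.card_roots' _
        _ ≤ _ := by rw [Polynomial.natDegree_sub_C]; exact hdeg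

theorem hausdorffMeasure_level_inter_closedBall_le {n : ℕ} (f : MvPolynomial (Fin (n + 1)) ℝ)
    {d : ℝ} (hd : ∀ x : Fin (n + 1) → ℝ, eval x f = d → ∃ i, eval x (pderiv i f) ≠ 0)
    {R : ℝ} (hR : 0 ≤ R) :
    μH[(n : ℝ)] (Metric.closedBall 0 R ∩ {x : Fin (n + 1) → ℝ | eval x f = d}) ≤
      ENNReal.ofReal ((n + 1) * ((2 * n + 1) ^ n * (f.totalDegree * (2 * R) ^ n))) := by
  let S : Fin (n + 1) → Set (Fin (n + 1) → ℝ) := fun i =>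
    Metric.closedBall 0 R ∩ {x | eval x f = d} ∩
      ({x | eval x (pderiv i f) ≠ 0} ∩ {x | ∀ j, |eval x (pderiv j f)| ≤ |eval x (pderiv i f)|})
  have hc : ∀ p : MvPolynomial (Fin (n + 1)) ℝ, Continuous fun x : Fin (n + 1) → ℝ => eval x p :=
    fun p => continuous_eval p
  have hSm : ∀ i, MeasurableSet (S i) := by
    intro i
    refine (Metric.isClosed_closedBall.inter (isClosed_eq (hc f) continuous_const)).measurableSet.inter
      ((isOpen_ne_fun (hc _) continuous_const).measurableSet.inter (IsClosed.measurableSet ?_))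
    simp only [Set.ofPred_forall]
    exact isClosed_iInter fun j => isClosed_le (hc _).abs (hc _).abs
  have hcover : Metric.closedBall 0 R ∩ {x : Fin (n + 1) → ℝ | eval x f = d} ⊆ ⋃ i, S i := by
    intro x hx
    obtain ⟨k, hk⟩ := hd x hx.2
    obtain ⟨i, hi⟩ := Finite.exists_max fun j => |eval x (pderiv j f)|
    exact Set.mem_iUnion.2 ⟨i, hx, abs_pos.1 ((abs_pos.2 hk).trans_le (hi k)), hi⟩
  have hS : ∀ i, μH[(n : ℝ)] (S i) ≤
      ENNReal.ofReal ((2 * n + 1) ^ n * (f.totalDegree * (2 * R) ^ n)) := by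
    intro i
    have hcont : Continuous (i.removeNth : (Fin (n + 1) → ℝ) → Fin n → ℝ) :=
      continuous_pi fun j => continuous_apply _
    have hSi : S i ⊆ {x | eval x f = d ∧ eval x (pderiv i f) ≠ 0} := fun x hx => ⟨hx.1.2, hx.2.1⟩
    have h := hausdorffMeasure_le_of_locally_antilipschitz (L := 2 * n + 1) (D := f.totalDegree)
      hcont (hSm i) (Nat.cast_nonneg n)
      (fun x hx => by
        obtain ⟨V, hV, h⟩ := exists_nhds_dist_le_removeNth f i hx.2.1 hx.2.2
        refine ⟨V, hV, fun y hy z hz => ?_⟩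
        exact_mod_cast h y hy.2 z hz.2 ((show eval y f = d from hy.1.1.2).trans
          (show eval z f = d from hz.1.1.2).symm))
      (fun w => (Set.encard_le_encard (Set.inter_subset_inter_left _ hSi)).trans
        (encard_fiber_removeNth_le f i d w))
      (W := Metric.closedBall 0 R) measurableSet_closedBall
      (fun x hx => by
        have hx := mem_closedBall_zero_iff.1 hx.1.1
        rw [mem_closedBall_zero_iff, pi_norm_le_iff_of_nonneg hR]
        exact fun j => (norm_le_pi_norm x _).trans hx)
    have hvol : μH[(n : ℝ)] (Metric.closedBall (0 : Fin n → ℝ) R) = ENNReal.ofReal ((2 * R) ^ n) := by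
      have := hausdorffMeasure_pi_real (ι := Fin n)
      rw [Fintype.card_fin] at this
      rw [this, Real.volume_pi_closedBall _ hR, Fintype.card_fin]
    rw [hvol, ENNReal.rpow_natCast] at h
    refine h.trans (le_of_eq ?_)
    rw [ENNReal.ofReal_mul (by positivity), ENNReal.ofReal_mul (by positivity),
      ENNReal.ofReal_natCast, ENNReal.ofReal_pow (p := 2 * (n : ℝ) + 1) (by positivity),
      ← ENNReal.ofReal_coe_nnreal]
    norm_num
  calc _ ≤ ∑ i, μH[(n : ℝ)] (S i) := (measure_mono hcover).trans (measure_iUnion_fintype_le _ _)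
    _ ≤ ∑ _i : Fin (n + 1), ENNReal.ofReal ((2 * n + 1) ^ n * (f.totalDegree * (2 * R) ^ n)) :=
      Finset.sum_le_sum fun i _ => hS i
    _ = _ := by
      rw [Finset.sum_const, Finset.card_univ, Fintype.card_fin, nsmul_eq_mul,
        ENNReal.ofReal_mul (p := (n : ℝ) + 1) (by positivity), ← Nat.cast_add_one,
        ENNReal.ofReal_natCast]

theorem lintegral_one_add_norm_sq_rpow_neg_lt_top {E : Type*} [NormedAddCommGroup E]
    [MeasurableSpace E] [OpensMeasurableSpace E] (μ : Measure E) {A : ℝ} {M : ℕ}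
    (hμ : ∀ R : ℝ, 1 ≤ R → μ (Metric.closedBall 0 R) ≤ ENNReal.ofReal (A * R ^ M)) :
    ∫⁻ x, ENNReal.ofReal ((1 + ‖x‖ ^ 2) ^ (-((M + 1 : ℕ) : ℝ))) ∂μ < ⊤ := by
  let T : ℕ → Set E := fun k => {x | ⌊‖x‖⌋₊ = k}
  have hTm : ∀ k, MeasurableSet (T k) := fun k =>
    (Nat.measurable_floor.comp measurable_norm) (measurableSet_singleton k)
  have hT : ⋃ k, T k = Set.univ := Set.eq_univ_of_forall fun x => Set.mem_iUnion.2 ⟨_, rfl⟩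
  have hbound : ∀ k, ∫⁻ x in T k, ENNReal.ofReal ((1 + ‖x‖ ^ 2) ^ (-((M + 1 : ℕ) : ℝ))) ∂μ ≤
      ENNReal.ofReal (2 ^ (M + 1) * |A| * (1 / ((k : ℝ) + 1) ^ 2)) := by
    intro k
    have hk : (0 : ℝ) < k + 1 := by positivity
    calc _ ≤ ∫⁻ x in T k, ENNReal.ofReal (2 ^ (M + 1) / ((k : ℝ) + 1) ^ (2 * (M + 1))) ∂μ := by
          refine setLIntegral_mono' (hTm k) fun x hx => ENNReal.ofReal_le_ofReal ?_
          have hkx : (k : ℝ) ≤ ‖x‖ := by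
            rw [← show ⌊‖x‖⌋₊ = k from hx]
            exact Nat.floor_le (norm_nonneg x)
          have h1 : ((k : ℝ) + 1) ^ 2 / 2 ≤ 1 + ‖x‖ ^ 2 := by
            have : (k : ℝ) ^ 2 ≤ ‖x‖ ^ 2 := by gcongr
            linarith [sq_nonneg ((k : ℝ) - 1)]
          rw [Real.rpow_neg (by positivity), Real.rpow_natCast, pow_mul, ← inv_div, ← div_pow]
          gcongr
      _ = ENNReal.ofReal (2 ^ (M + 1) / ((k : ℝ) + 1) ^ (2 * (M + 1))) * μ (T k) :=
          setLIntegral_const _ _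
      _ ≤ ENNReal.ofReal (2 ^ (M + 1) / ((k : ℝ) + 1) ^ (2 * (M + 1))) *
          ENNReal.ofReal (|A| * ((k : ℝ) + 1) ^ M) := by
          gcongr
          refine (measure_mono fun x hx => ?_).trans ((hμ ((k : ℝ) + 1) (by simp)).trans
            (ENNReal.ofReal_le_ofReal (by gcongr; exact le_abs_self A)))
          rw [mem_closedBall_zero_iff, ← show ⌊‖x‖⌋₊ = k from hx]
          exact (Nat.lt_floor_add_one _).le
      _ = ENNReal.ofReal (2 ^ (M + 1) / ((k : ℝ) + 1) ^ (2 * (M + 1)) *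
          (|A| * ((k : ℝ) + 1) ^ M)) := (ENNReal.ofReal_mul (by positivity)).symm
      _ ≤ _ := by
          apply ENNReal.ofReal_le_ofReal
          have h1 : (1 : ℝ) ≤ ((k : ℝ) + 1) ^ M := one_le_pow₀ (by simp)
          rw [show ((k : ℝ) + 1) ^ (2 * (M + 1)) = (k + 1) ^ M * (k + 1) ^ M * (k + 1) ^ 2 by ring,
            show 2 ^ (M + 1) / (((k : ℝ) + 1) ^ M * ((k : ℝ) + 1) ^ M * ((k : ℝ) + 1) ^ 2) *
              (|A| * ((k : ℝ) + 1) ^ M) =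
              2 ^ (M + 1) * |A| * (1 / (((k : ℝ) + 1) ^ M * ((k : ℝ) + 1) ^ 2)) by field_simp]
          gcongr
          exact le_mul_of_one_le_left (by positivity) h1
  have hsum : Summable fun k : ℕ => 2 ^ (M + 1) * |A| * (1 / ((k : ℝ) + 1) ^ 2) := by
    have := (summable_nat_add_iff 1).2 (Real.summable_one_div_nat_pow.2 one_lt_two)
    exact (by simpa using this : Summable fun k : ℕ => 1 / ((k : ℝ) + 1) ^ 2).mul_left _
  calc _ = ∫⁻ x in ⋃ k, T k, ENNReal.ofReal ((1 + ‖x‖ ^ 2) ^ (-((M + 1 : ℕ) : ℝ))) ∂μ := by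
        rw [hT, setLIntegral_univ]
    _ ≤ _ := lintegral_iUnion_le _ _
    _ ≤ _ := ENNReal.tsum_le_tsum hbound
    _ < ⊤ := by
        rw [← ENNReal.ofReal_tsum_of_nonneg (fun k => by positivity) hsum]
        exact ENNReal.ofReal_lt_top

/-- Around a non-critical value there is a closed interval of non-critical values. -/
theorem exists_pos_forall_abs_eval_sub_le_imp_exists_pderiv_ne_zero {σ : Type*} [Finite σ]
    (f : MvPolynomial σ ℝ) {c : ℝ}
    (hc : ∀ x : σ → ℝ, eval x f = c → ∃ i, eval x (pderiv i f) ≠ 0) :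
    ∃ ε > (0 : ℝ), ∀ x : σ → ℝ, |eval x f - c| ≤ ε → ∃ i, eval x (pderiv i f) ≠ 0 := by
  obtain ⟨δ, hδ, hball⟩ := Metric.isOpen_iff.1 (finite_criticalValues f).isClosed.isOpen_compl c
    (by
      rintro ⟨x, hx, hx0⟩
      obtain ⟨i, hi⟩ := hc x hx
      exact hi (hx0 i))
  refine ⟨δ / 2, half_pos hδ, fun x hx => ?_⟩
  by_contra! h
  refine hball (a := eval x f) ?_ ⟨x, rfl, h⟩
  rw [Metric.mem_ball, Real.dist_eq]
  linarith

/-- If `f` has no critical point on `f⁻¹(d)` and `‖∇f‖` is bounded below there by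
`a * (1 + ‖x‖) ^ (-N)`, then the mass which `levelMeasure f d` gives to a ball grows at most
polynomially in the radius, with constants not depending on `d`. -/
theorem levelMeasure_closedBall_le {n : ℕ} (f : MvPolynomial (Fin (n + 1)) ℝ) {d a : ℝ} {N : ℕ}
    (hd : ∀ x : Fin (n + 1) → ℝ, eval x f = d → ∃ i, eval x (pderiv i f) ≠ 0) (ha : 0 < a)
    (hN : ∀ x : Fin (n + 1) → ℝ, eval x f = d → a ≤ gradNorm f x * (1 + ‖x‖) ^ N)
    {R : ℝ} (hR : 1 ≤ R) :
    levelMeasure f d (Metric.closedBall 0 R) ≤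
      ENNReal.ofReal (2 ^ N / a * ((n + 1) * ((2 * n + 1) ^ n * (f.totalDegree * 2 ^ n))) *
        R ^ (n + N)) := by
  have hR0 : 0 ≤ R := zero_le_one.trans hR
  have hcont : Continuous fun x : Fin (n + 1) → ℝ => eval x f := continuous_eval f
  have hm : MeasurableSet {x : Fin (n + 1) → ℝ | eval x f = d} :=
    (isClosed_eq hcont continuous_const).measurableSet
  have hn : ((n + 1 : ℕ) : ℝ) - 1 = n := by simp
  rw [levelMeasure, hn, withDensity_apply _ measurableSet_closedBall,
    Measure.restrict_restrict measurableSet_closedBall]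
  calc _ ≤ ∫⁻ _ in Metric.closedBall 0 R ∩ {x : Fin (n + 1) → ℝ | eval x f = d},
          ENNReal.ofReal ((2 * R) ^ N / a) ∂μH[(n : ℝ)] := by
        refine setLIntegral_mono' (measurableSet_closedBall.inter hm) fun x hx =>
          ENNReal.ofReal_le_ofReal ?_
        have hxR : ‖x‖ ≤ R := mem_closedBall_zero_iff.1 hx.1
        have hax := hN x hx.2
        have hpow : (1 + ‖x‖) ^ N ≤ (2 * R) ^ N := by
          gcongr
          linarith
        have hg0 : 0 ≤ gradNorm f x := norm_nonneg _
        have hg : 0 < gradNorm f x := hg0.lt_of_ne' fun h => by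
          rw [h, zero_mul] at hax
          linarith
        rw [inv_le_iff_one_le_mul₀ hg, div_mul_eq_mul_div, one_le_div ha]
        nlinarith
    _ = ENNReal.ofReal ((2 * R) ^ N / a) * μH[(n : ℝ)] (Metric.closedBall 0 R ∩
          {x : Fin (n + 1) → ℝ | eval x f = d}) := setLIntegral_const _ _
    _ ≤ ENNReal.ofReal ((2 * R) ^ N / a) *
          ENNReal.ofReal ((n + 1) * ((2 * n + 1) ^ n * (f.totalDegree * (2 * R) ^ n))) := by
        gcongr
        exact hausdorffMeasure_level_inter_closedBall_le f hd hR0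
    _ = _ := by
        rw [← ENNReal.ofReal_mul (by positivity)]
        congr 1
        rw [mul_pow, mul_pow, pow_add]
        ring

/-- **Igusa–Raghavan.** Let `f : ℝ^m → ℝ` be a non-constant
polynomial and `c` a non-critical value of `f`.  Then there exist `A > 0`,
`γ ≥ 0` and an open neighborhood `U` of `c` consisting of non-critical values
such that `μ_d(B_R) ≤ A · R^{m−1+γ}` for all `R ≥ 1`, `d ∈ U`; in particular
`μ_c` is tempered. -/
theorem stmt19 {m : ℕ} (f : MvPolynomial (Fin m) ℝ) (hf : f.totalDegree ≠ 0)
    (c : ℝ) (hc : ∀ x : Fin m → ℝ, eval x f = c → ∃ i, eval x (pderiv i f) ≠ 0) :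
    ∃ A > (0 : ℝ), ∃ γ : ℝ, 0 ≤ γ ∧ ∃ U : Set ℝ, IsOpen U ∧ c ∈ U ∧
      (∀ d ∈ U, ∀ x : Fin m → ℝ, eval x f = d → ∃ i, eval x (pderiv i f) ≠ 0) ∧
      (∀ d ∈ U, ∀ R : ℝ, 1 ≤ R →
        levelMeasure f d (Metric.closedBall 0 R) ≤
          ENNReal.ofReal (A * R ^ ((m : ℝ) - 1 + γ))) ∧
      ∃ α : ℤ, ∫⁻ x, ENNReal.ofReal ((1 + ‖x‖ ^ 2) ^ (-(α : ℝ))) ∂(levelMeasure f c) < ⊤ := by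
  rcases m with _ | n
  · exact (hf (by rw [eq_C_of_isEmpty f, totalDegree_C])).elim
  obtain ⟨ε, hε, hcrit⟩ := exists_pos_forall_abs_eval_sub_le_imp_exists_pderiv_ne_zero f hc
  obtain ⟨a, ha, N, hN⟩ := exists_gradNorm_lower_bound f hε hcrit
  have hU : ∀ d ∈ Metric.ball c ε, ∀ x : Fin (n + 1) → ℝ, eval x f = d → |eval x f - c| ≤ ε :=
    fun d hd x hx => hx ▸ (Metric.mem_ball.1 hd).le
  have hbound := fun d hd R (hR : 1 ≤ R) => levelMeasure_closedBall_le f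
    (fun x hx => hcrit x (hU d hd x hx)) ha (fun x hx => hN x (hU d hd x hx)) hR
  have hdeg : (0 : ℝ) < f.totalDegree := by exact_mod_cast Nat.pos_of_ne_zero hf
  refine ⟨2 ^ N / a * ((n + 1) * ((2 * n + 1) ^ n * (f.totalDegree * 2 ^ n))), by positivity, N,
    N.cast_nonneg, Metric.ball c ε, Metric.isOpen_ball, Metric.mem_ball_self hε,
    fun d hd x hx => hcrit x (hU d hd x hx), fun d hd R hR => ?_, (n + N + 1 : ℕ), ?_⟩
  · have hexp : ((n + 1 : ℕ) : ℝ) - 1 + N = (n + N : ℕ) := by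
      push_cast
      ring
    rw [hexp, Real.rpow_natCast]
    exact hbound d hd R hR
  · rw [Int.cast_natCast]
    exact lintegral_one_add_norm_sq_rpow_neg_lt_top _
      fun R hR => hbound c (Metric.mem_ball_self hε) R hR
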